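/- arXiv:2211.15879 — 3 statements merged into one kernel-verified Lean document; each statement's English description precedes it below -/
import Mathlib

section
/- Let λ, μ be Lamé constants with μ > 0 and 3λ + 2μ > 0, and let k₀, α₁, α₂ and the Kelvin matrix Γ be as defined. For every b, ν ∈ ℝ³ and every x ≠ 0, the vector field u(x) := Γ(x)b satisfies −μ ν × (∇×u)(x) + (μ/(2k₀)) (∇·u)(x) ν = [ (x·b)ν − (ν·b)x ] / (4π|x|³) + [ (x·ν) / (4π|x|³) ] b. In particular, the left-hand side does not depend on the Lamé constants (λ, μ). -/
noncomputable section

open scoped BigOperators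

/-- Points of `ℝ³`. -/
abbrev V3 : Type := Fin 3 → ℝ

/-- The Euclidean inner product on `ℝ³`. -/
def dot3 (x y : V3) : ℝ := ∑ i, x i * y i

/-- The Euclidean norm on `ℝ³`. -/
def norm3 (x : V3) : ℝ := Real.sqrt (dot3 x x)

/-- The cross product on `ℝ³` (cyclic formula, `(x × y) i = x (i+1) y (i+2) - x (i+2) y (i+1)`). -/
def cross3 (x y : V3) : V3 := fun i => x (i + 1) * y (i + 2) - x (i + 2) * y (i + 1)

/-- Partial derivative in the `i`-th coordinate direction. -/
def pd (i : Fin 3) (f : V3 → ℝ) (x : V3) : ℝ := fderiv ℝ f x (Pi.single i 1)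

/-- Gradient of a scalar field. -/
def grad3 (f : V3 → ℝ) (x : V3) : V3 := fun i => pd i f x

/-- Divergence of a vector field. -/
def div3 (p : V3 → V3) (x : V3) : ℝ := ∑ i, pd i (fun y => p y i) x

/-- Curl of a vector field. -/
def curl3 (p : V3 → V3) (x : V3) : V3 :=
  fun i => pd (i + 1) (fun y => p y (i + 2)) x - pd (i + 2) (fun y => p y (i + 1)) x

/-- `f` is the function of a homogeneous polynomial of degree `k` on `ℝ³`. -/
def IsHomogPoly (k : ℕ) (f : V3 → ℝ) : Prop :=
  ∃ q : MvPolynomial (Fin 3) ℝ, q.IsHomogeneous k ∧ ∀ x, f x = MvPolynomial.eval x q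

/-- `f` is harmonic (its Laplacian vanishes) on all of `ℝ³`. -/
def IsHarmonic (f : V3 → ℝ) : Prop := ∀ x, ∑ i, pd i (pd i f) x = 0

/-- `P_k`: homogeneous harmonic polynomials of degree `k` (as functions on `ℝ³`). -/
def Pk (k : ℕ) : Set (V3 → ℝ) := {f | IsHomogPoly k f ∧ IsHarmonic f}

/-- `P_k³`: vector fields all of whose components lie in `P_k`. -/
def Pk3 (k : ℕ) : Set (V3 → V3) := {p | ∀ i, (fun x => p x i) ∈ Pk k}

/-- Kelvin transform of a degree-`k` homogeneous field: `p*(x) = |x|^{-(2k+1)} p(x)`. -/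
def kelvin (k : ℕ) (p : V3 → V3) : V3 → V3 := fun x => (norm3 x ^ (2 * k + 1))⁻¹ • p x

/-- `W_k^o`: fields in `P_k³` that are divergence free on `ℝ³` and whose Kelvin transform
is divergence free on `ℝ³ \ {0}`. -/
def Wko (k : ℕ) : Set (V3 → V3) :=
  {p | p ∈ Pk3 k ∧ (∀ x, div3 p x = 0) ∧ ∀ x : V3, x ≠ 0 → div3 (kelvin k p) x = 0}

/-- `W_k^-`: fields in `P_k³` that are divergence free and curl free on `ℝ³`. -/
def Wkm (k : ℕ) : Set (V3 → V3) :=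
  {p | p ∈ Pk3 k ∧ (∀ x, div3 p x = 0) ∧ ∀ x, curl3 p x = 0}

/-- `W_k^+`: fields in `P_k³` whose Kelvin transform is divergence free and curl free
on `ℝ³ \ {0}`. -/
def Wkp (k : ℕ) : Set (V3 → V3) :=
  {p | p ∈ Pk3 k ∧ (∀ x : V3, x ≠ 0 → div3 (kelvin k p) x = 0) ∧
    ∀ x : V3, x ≠ 0 → curl3 (kelvin k p) x = 0}

/-- `k₀ := μ/(2(λ+2μ))`. -/
def lameK0 (lam mu : ℝ) : ℝ := mu / (2 * (lam + 2 * mu))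

/-- `α₁ := (1/2)(1/μ + 1/(λ+2μ))`. -/
def lameA1 (lam mu : ℝ) : ℝ := (1 / 2) * (1 / mu + 1 / (lam + 2 * mu))

/-- `α₂ := (1/2)(1/μ − 1/(λ+2μ))`. -/
def lameA2 (lam mu : ℝ) : ℝ := (1 / 2) * (1 / mu - 1 / (lam + 2 * mu))

/-- The Kelvin matrix applied to a constant vector `b`:
`Γ(x)b = −(α₁/(4π)) b/|x| − (α₂/(4π)) ((x·b)/|x|³) x`. -/
def kelvinGamma (lam mu : ℝ) (b : V3) : V3 → V3 := fun x =>
  (-(lameA1 lam mu / (4 * Real.pi)) * (norm3 x)⁻¹) • b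
    - ((lameA2 lam mu / (4 * Real.pi)) * (dot3 x b / norm3 x ^ 3)) • x

lemma dot3_self_pos {x : V3} (hx : x ≠ 0) : 0 < dot3 x x := by
  obtain ⟨i, hi⟩ := Function.ne_iff.mp hx
  exact Finset.sum_pos' (fun j _ => mul_self_nonneg (x j))
    ⟨i, Finset.mem_univ i, mul_self_pos.mpr hi⟩

lemma norm3_pos {x : V3} (hx : x ≠ 0) : 0 < norm3 x :=
  Real.sqrt_pos.mpr (dot3_self_pos hx)

lemma norm3_sq (x : V3) : norm3 x ^ 2 = dot3 x x :=
  Real.sq_sqrt (Finset.sum_nonneg fun i _ => mul_self_nonneg (x i))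

lemma hasFDerivAt_dot3_left (b x : V3) :
    HasFDerivAt (fun y => dot3 y b)
      (∑ i, b i • ContinuousLinearMap.proj (R := ℝ) (φ := fun _ : Fin 3 => ℝ) i) x := by
  unfold dot3
  exact HasFDerivAt.fun_sum fun i _ => (hasFDerivAt_apply i x).mul_const (b i)

lemma hasFDerivAt_norm3 {x : V3} (hx : x ≠ 0) :
    HasFDerivAt norm3
      ((norm3 x)⁻¹ • ∑ i, x i • ContinuousLinearMap.proj (R := ℝ) (φ := fun _ : Fin 3 => ℝ) i)
      x := by
  have h : HasFDerivAt (fun y => dot3 y y)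
      (∑ i, (x i • ContinuousLinearMap.proj (R := ℝ) (φ := fun _ : Fin 3 => ℝ) i
        + x i • ContinuousLinearMap.proj (R := ℝ) (φ := fun _ : Fin 3 => ℝ) i)) x := by
    unfold dot3
    exact HasFDerivAt.fun_sum fun i _ => (hasFDerivAt_apply i x).mul (hasFDerivAt_apply i x)
  refine (h.sqrt (dot3_self_pos hx).ne').congr_fderiv ?_
  have hr := (norm3_pos hx).ne'
  change (1 / (2 * norm3 x)) • _ = _
  rw [Finset.sum_add_distrib, ← two_smul ℝ, smul_smul]
  congr 1
  field_simp

/-- The partial derivatives of the components of the Kelvin matrix applied to `b`. -/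
lemma pd_kelvinGamma (lam mu : ℝ) (b : V3) {x : V3} (hx : x ≠ 0) (i j : Fin 3) :
    pd i (fun y => kelvinGamma lam mu b y j) x =
      lameA1 lam mu / (4 * Real.pi) * (x i * b j / norm3 x ^ 3)
        - lameA2 lam mu / (4 * Real.pi) *
          ((b i * x j + dot3 x b * (if j = i then 1 else 0)) / norm3 x ^ 3
            - 3 * dot3 x b * x i * x j / norm3 x ^ 5) := by
  have hr := (norm3_pos hx).ne'
  have hn := hasFDerivAt_norm3 hx
  have hinv := (hasDerivAt_inv hr).comp_hasFDerivAt x hn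
  have hcube := (hasDerivAt_inv (pow_ne_zero 3 hr)).comp_hasFDerivAt x (hn.pow 3)
  have h := ((hinv.const_mul (-(lameA1 lam mu / (4 * Real.pi)))).mul_const (b j)).sub
    ((((hasFDerivAt_dot3_left b x).mul hcube).const_mul (lameA2 lam mu / (4 * Real.pi))).mul
      (hasFDerivAt_apply j x))
  refine (congrArg (fun L => L (Pi.single i 1)) h.fderiv).trans ?_
  by_cases hij : j = i <;> simp [Pi.single_apply, hij] <;> field_simp <;> ring

lemma curl3_kelvinGamma (lam : ℝ) {mu : ℝ} (b : V3) {x : V3} (hx : x ≠ 0) :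
    curl3 (kelvinGamma lam mu b) x = (mu * (4 * Real.pi * norm3 x ^ 3))⁻¹ • cross3 x b := by
  have hA : lameA1 lam mu = mu⁻¹ - lameA2 lam mu := by
    unfold lameA1 lameA2
    ring
  funext i
  have hne : i + 2 ≠ i + 1 := by simp
  simp only [curl3, pd_kelvinGamma lam mu b hx, cross3, Pi.smul_apply, smul_eq_mul, hA,
    if_neg hne, if_neg hne.symm]
  ring

lemma div3_kelvinGamma (lam mu : ℝ) (b : V3) {x : V3} (hx : x ≠ 0) :
    div3 (kelvinGamma lam mu b) x =
      ((lam + 2 * mu) * (4 * Real.pi * norm3 x ^ 3))⁻¹ * dot3 x b := by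
  have hA : lameA1 lam mu = (lam + 2 * mu)⁻¹ + lameA2 lam mu := by
    unfold lameA1 lameA2
    ring
  have hr := (norm3_pos hx).ne'
  have hb : ∑ i, x i * b i = dot3 x b := rfl
  have hs : x 0 * x 0 + x 1 * x 1 + x 2 * x 2 = norm3 x ^ 2 := by
    rw [norm3_sq, dot3, Fin.sum_univ_three]
  have h5 : norm3 x ^ 2 / norm3 x ^ 5 = (norm3 x ^ 3)⁻¹ := by
    field_simp
  rw [Fin.sum_univ_three] at hb
  simp only [div3, pd_kelvinGamma lam mu b hx, Fin.sum_univ_three, hA, if_true,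
    mul_inv (lam + 2 * mu)]
  linear_combination
    (lam + 2 * mu)⁻¹ / (4 * Real.pi) / norm3 x ^ 3 * hb
      + lameA2 lam mu / (4 * Real.pi) * 3 * dot3 x b / norm3 x ^ 5 * hs
      + lameA2 lam mu / (4 * Real.pi) * 3 * dot3 x b * h5

/-- The expansion of the vector triple product. -/
lemma cross3_cross3 (a b c : V3) : cross3 a (cross3 b c) = dot3 a c • b - dot3 a b • c := by
  funext i
  fin_cases i <;> simp [cross3, dot3, Fin.sum_univ_three] <;> ring

/-- For Lamé constants with `μ > 0`, `3λ + 2μ > 0`, the field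
`u(x) = Γ(x)b` satisfies, for every `b, ν ∈ ℝ³` and `x ≠ 0`,
`−μ ν × (∇×u)(x) + (μ/(2k₀)) (∇·u)(x) ν
  = [(x·b)ν − (ν·b)x]/(4π|x|³) + [(x·ν)/(4π|x|³)] b`;
in particular the left-hand side does not depend on `(λ, μ)`. -/
theorem divFree_conormal_kelvinGamma (lam mu : ℝ) (hmu : 0 < mu)
    (hlm : 0 < 3 * lam + 2 * mu) (b ν : V3) (x : V3) (hx : x ≠ 0) :
    (-mu) • cross3 ν (curl3 (kelvinGamma lam mu b) x)
        + ((mu / (2 * lameK0 lam mu)) * div3 (kelvinGamma lam mu b) x) • ν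
      = (4 * Real.pi * norm3 x ^ 3)⁻¹ • (dot3 x b • ν - dot3 ν b • x)
        + (dot3 x ν / (4 * Real.pi * norm3 x ^ 3)) • b := by
  have hpos : lam + 2 * mu ≠ 0 := by linarith
  have hk : mu / (2 * lameK0 lam mu) = lam + 2 * mu := by
    unfold lameK0
    field_simp
  have hr := (norm3_pos hx).ne'
  have hc : ∀ c : ℝ, cross3 ν (c • cross3 x b) = c • cross3 ν (cross3 x b) := by
    intro c
    funext i
    simp only [cross3, Pi.smul_apply, smul_eq_mul]
    ring
  have hcomm : dot3 ν x = dot3 x ν := Finset.sum_congr rfl fun i _ => mul_comm _ _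
  rw [curl3_kelvinGamma lam b hx, div3_kelvinGamma lam mu b hx, hk, hc, cross3_cross3, hcomm]
  funext i
  simp only [Pi.add_apply, Pi.sub_apply, Pi.smul_apply, smul_eq_mul]
  generalize lam + 2 * mu = M at hpos
  field_simp
  ring
end
end

section
/- Under the stated kernel and measure hypotheses, assume in addition that the function x ↦ ∫_S T(x,y) dσ(y) is constant on S. Then for all real numbers t, s with 0 ≤ s < γ, t ≥ max{0, s − β − γ + 1}, and (t, s) ≠ (0, β + γ − 1), there exists a constant C such that ‖Tφ‖_{H^s} ≤ C ‖φ‖_{H^t} for all φ with ‖φ‖_{H^t} < ∞; that is, T is a bounded linear operator from H^t(σ) into H^s(σ). -/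
noncomputable section

open MeasureTheory
open scoped BigOperators ENNReal NNReal

/-- The (squared) Sobolev–Gagliardo `H^s(σ)` norm of a function `φ` on `S ⊂ ℝ^m`:
`‖φ‖_{H^s}² = ∫_S |φ|² dσ + ∬_{S×S} |φ(x) − φ(y)|² / |x−y|^{m−1+2s} dσ(x) dσ(y)`,
the double-integral term being omitted when `s = 0`. -/
def hsNormSq {E : Type*} [NormedAddCommGroup E] [MeasurableSpace E]
    (m : ℕ) (σ : Measure E) (S : Set E) (s : ℝ) (φ : E → ℝ) : ℝ≥0∞ :=
  (∫⁻ x in S, ENNReal.ofReal ((φ x) ^ 2) ∂σ) +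
    if s = 0 then 0 else
      ∫⁻ x in S, ∫⁻ y in S,
        ENNReal.ofReal ((φ x - φ y) ^ 2 / ‖x - y‖ ^ ((m : ℝ) - 1 + 2 * s)) ∂σ ∂σ

/-- `d` is a measurable, almost everywhere positive function whose sublevel sets `{d < r}` have
`ν`-measure at most `C * r ^ n`. -/
structure HasSublevelGrowth {X : Type*} [MeasurableSpace X] (ν : Measure X) (d : X → ℝ)
    (C n : ℝ) : Prop where
  measurable : Measurable d
  ae_pos : ∀ᵐ y ∂ν, 0 < d y
  growth : ∀ r : ℝ, 0 < r → ν {y | d y < r} ≤ ENNReal.ofReal (C * r ^ n)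

lemma Real.rpow_le_of_mem_dyadic {ρ u p : ℝ} (hρ : 0 < ρ) (h1 : ρ ≤ u) (h2 : u ≤ 2 * ρ) :
    u ^ p ≤ 2 ^ |p| * ρ ^ p := by
  rcases le_total 0 p with hp | hp
  · rw [abs_of_nonneg hp, ← Real.mul_rpow (by norm_num) hρ.le]
    exact Real.rpow_le_rpow (hρ.le.trans h1) h2 hp
  · calc u ^ p ≤ ρ ^ p := Real.rpow_le_rpow_of_nonpos hρ h1 hp
      _ ≤ 2 ^ |p| * ρ ^ p :=
        le_mul_of_one_le_left (Real.rpow_nonneg hρ.le _)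
          (Real.one_le_rpow (by norm_num) (abs_nonneg p))

lemma setLIntegral_rpow_dyadic_le {X : Type*} [MeasurableSpace X] {ν : Measure X} {d : X → ℝ}
    {C n : ℝ} (h : HasSublevelGrowth ν d C n) {ρ : ℝ} (hρ : 0 < ρ) (p : ℝ) :
    ∫⁻ y in {y | ρ ≤ d y ∧ d y ≤ 2 * ρ}, ENNReal.ofReal (d y ^ p) ∂ν ≤
      ENNReal.ofReal (2 ^ |p| * (4 ^ n * C) * ρ ^ (p + n)) := by
  have hd := h.measurable
  have hms : MeasurableSet {y | ρ ≤ d y ∧ d y ≤ 2 * ρ} :=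
    (measurableSet_le measurable_const hd).inter (measurableSet_le hd measurable_const)
  calc ∫⁻ y in {y | ρ ≤ d y ∧ d y ≤ 2 * ρ}, ENNReal.ofReal (d y ^ p) ∂ν
      ≤ ∫⁻ _ in {y | ρ ≤ d y ∧ d y ≤ 2 * ρ}, ENNReal.ofReal (2 ^ |p| * ρ ^ p) ∂ν :=
        setLIntegral_mono' hms fun y hy =>
          ENNReal.ofReal_le_ofReal (Real.rpow_le_of_mem_dyadic hρ hy.1 hy.2)
    _ = ENNReal.ofReal (2 ^ |p| * ρ ^ p) * ν {y | ρ ≤ d y ∧ d y ≤ 2 * ρ} := setLIntegral_const _ _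
    _ ≤ ENNReal.ofReal (2 ^ |p| * ρ ^ p) * ENNReal.ofReal (C * (4 * ρ) ^ n) := by
        gcongr
        refine (measure_mono fun y hy => ?_).trans (h.growth (4 * ρ) (by positivity))
        have := hy.2
        simp only [Set.mem_ofPred_eq]
        linarith
    _ = ENNReal.ofReal (2 ^ |p| * (4 ^ n * C) * ρ ^ (p + n)) := by
        rw [← ENNReal.ofReal_mul (by positivity), Real.mul_rpow (by norm_num) hρ.le,
          Real.rpow_add hρ]
        congr 1
        ring

lemma setLIntegral_rpow_le_of_subset_iUnion {X : Type*} [MeasurableSpace X] {ν : Measure X}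
    {d : X → ℝ} {C n : ℝ} (hC : 0 ≤ C) (h : HasSublevelGrowth ν d C n) {p R q : ℝ} (hR : 0 ≤ R)
    (hq0 : 0 ≤ q) (hq1 : q < 1) {ρ : ℕ → ℝ} (hρ : ∀ k, 0 < ρ k)
    (hρR : ∀ k, ρ k ^ (p + n) ≤ R * q ^ k) {A : Set X}
    (hA : A ⊆ ⋃ k, {y | ρ k ≤ d y ∧ d y ≤ 2 * ρ k}) :
    ∫⁻ y in A, ENNReal.ofReal (d y ^ p) ∂ν ≤
      (2 ^ |p| * (4 ^ n * C) * (1 - q)⁻¹).toNNReal * ENNReal.ofReal R := by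
  calc ∫⁻ y in A, ENNReal.ofReal (d y ^ p) ∂ν
      ≤ ∫⁻ y in ⋃ k, {y | ρ k ≤ d y ∧ d y ≤ 2 * ρ k}, ENNReal.ofReal (d y ^ p) ∂ν :=
        lintegral_mono_set hA
    _ ≤ ∑' k, ∫⁻ y in {y | ρ k ≤ d y ∧ d y ≤ 2 * ρ k}, ENNReal.ofReal (d y ^ p) ∂ν :=
        lintegral_iUnion_le _ _
    _ ≤ ∑' k, ENNReal.ofReal (2 ^ |p| * (4 ^ n * C) * R * q ^ k) := by
        refine ENNReal.tsum_le_tsum fun k => (setLIntegral_rpow_dyadic_le h (hρ k) p).trans ?_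
        refine ENNReal.ofReal_le_ofReal ?_
        rw [mul_assoc _ R]
        exact mul_le_mul_of_nonneg_left (hρR k) (by positivity)
    _ = ENNReal.ofReal (2 ^ |p| * (4 ^ n * C) * R * (1 - q)⁻¹) := by
        rw [← ENNReal.ofReal_tsum_of_nonneg (fun k => by positivity)
          ((summable_geometric_of_lt_one hq0 hq1).mul_left _), tsum_mul_left,
          tsum_geometric_of_lt_one hq0 hq1]
    _ = _ := by
        have : 0 ≤ (1 - q)⁻¹ := inv_nonneg.2 (by linarith)
        change _ = ENNReal.ofReal _ * _
        rw [← ENNReal.ofReal_mul (by positivity)]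
        congr 1
        ring

lemma exists_setLIntegral_rpow_lt_le (X : Type*) [MeasurableSpace X] {C n a : ℝ} (hC : 0 ≤ C)
    (ha : 0 < a) :
    ∃ K : ℝ≥0, ∀ (ν : Measure X) (d : X → ℝ), HasSublevelGrowth ν d C n → ∀ r : ℝ, 0 < r →
      ∫⁻ y in {y | d y < r}, ENNReal.ofReal (d y ^ (a - n)) ∂ν ≤ K * ENNReal.ofReal (r ^ a) := by
  refine ⟨(2 ^ |a - n| * (4 ^ n * C) * (1 - (2 : ℝ)⁻¹ ^ a)⁻¹).toNNReal, fun ν d h r hr => ?_⟩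
  have hq : ((2 : ℝ)⁻¹) ^ a < 1 := Real.rpow_lt_one (by norm_num) (by norm_num) ha
  have hae : ({y | d y < r} : Set X) =ᵐ[ν] {y | 0 < d y ∧ d y < r} := by
    filter_upwards [h.ae_pos] with y hy
    exact propext ⟨fun h => ⟨hy, h⟩, fun h => h.2⟩
  rw [setLIntegral_congr hae]
  refine setLIntegral_rpow_le_of_subset_iUnion hC h (by positivity) (by positivity) hq
    (ρ := fun k => r * (2 : ℝ)⁻¹ ^ (k + 1)) (fun k => by positivity) (fun k => ?_) fun y hy => ?_
  · rw [sub_add_cancel, Real.mul_rpow hr.le (by positivity)]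
    gcongr
    rw [← Real.rpow_natCast, ← Real.rpow_natCast, ← Real.rpow_mul (by norm_num),
      ← Real.rpow_mul (by norm_num)]
    refine Real.rpow_le_rpow_of_exponent_ge (by norm_num) (by norm_num) ?_
    push_cast
    nlinarith
  · obtain ⟨k, hk1, hk2⟩ := exists_nat_pow_near_of_lt_one (x := d y / r) (y := (2 : ℝ)⁻¹)
      (div_pos hy.1 hr) ((div_le_one hr).2 hy.2.le) (by norm_num) (by norm_num)
    refine Set.mem_iUnion.2 ⟨k, ?_, ?_⟩
    · rw [lt_div_iff₀ hr] at hk1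
      linarith
    · rw [div_le_iff₀ hr] at hk2
      refine hk2.trans (le_of_eq ?_)
      simp only [pow_succ]
      ring

lemma exists_setLIntegral_rpow_gt_le (X : Type*) [MeasurableSpace X] {C n a : ℝ} (hC : 0 ≤ C)
    (ha : 0 < a) :
    ∃ K : ℝ≥0, ∀ (ν : Measure X) (d : X → ℝ), HasSublevelGrowth ν d C n → ∀ r : ℝ, 0 < r →
      ∫⁻ y in {y | r < d y}, ENNReal.ofReal (d y ^ (-a - n)) ∂ν ≤
        K * ENNReal.ofReal (r ^ (-a)) := by
  refine ⟨(2 ^ |-a - n| * (4 ^ n * C) * (1 - (2 : ℝ) ^ (-a))⁻¹).toNNReal,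
    fun ν d h r hr => ?_⟩
  have hq : (2 : ℝ) ^ (-a) < 1 := Real.rpow_lt_one_of_one_lt_of_neg (by norm_num) (by linarith)
  refine setLIntegral_rpow_le_of_subset_iUnion hC h (by positivity) (by positivity) hq
    (ρ := fun k => r * 2 ^ k) (fun k => by positivity) (fun k => ?_) fun y hy => ?_
  · rw [sub_add_cancel, Real.mul_rpow hr.le (by positivity)]
    gcongr
    rw [← Real.rpow_natCast, ← Real.rpow_natCast, ← Real.rpow_mul (by norm_num),
      ← Real.rpow_mul (by norm_num), mul_comm]
  · obtain ⟨k, hk1, hk2⟩ := exists_nat_pow_near (x := d y / r) (y := (2 : ℝ))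
      ((one_le_div hr).2 (le_of_lt hy)) (by norm_num)
    refine Set.mem_iUnion.2 ⟨k, ?_, ?_⟩
    · rw [le_div_iff₀ hr] at hk1
      linarith
    · rw [div_lt_iff₀ hr] at hk2
      refine hk2.le.trans (le_of_eq ?_)
      simp only [pow_succ]
      ring

lemma sq_lintegral_mul_le {X : Type*} [MeasurableSpace X] {ν : Measure X} {F h : X → ℝ≥0∞}
    (hF : Measurable F) (hh : Measurable h) :
    (∫⁻ y, F y * h y ∂ν) ^ 2 ≤ (∫⁻ y, F y ∂ν) * ∫⁻ y, F y * h y ^ 2 ∂ν := by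
  have key := ENNReal.lintegral_mul_norm_pow_le (μ := ν) (f := F) (g := fun y => F y * h y ^ 2)
    (p := 1 / 2) (q := 1 / 2) hF.aemeasurable (hF.mul (hh.pow_const 2)).aemeasurable
    (by norm_num) (by norm_num) (by norm_num)
  have hroot (a : ℝ≥0∞) : (a ^ (1 / 2 : ℝ)) ^ 2 = a := by
    rw [← ENNReal.rpow_natCast, ← ENNReal.rpow_mul]
    norm_num
  have hroot' (a : ℝ≥0∞) : (a ^ 2) ^ (1 / 2 : ℝ) = a := by
    rw [← ENNReal.rpow_natCast, ← ENNReal.rpow_mul]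
    norm_num
  have hint (y : X) : F y ^ (1 / 2 : ℝ) * (F y * h y ^ 2) ^ (1 / 2 : ℝ) = F y * h y := by
    rw [ENNReal.mul_rpow_of_nonneg _ _ (by norm_num), hroot', ← mul_assoc, ← pow_two, hroot]
  simp only [hint] at key
  calc _ ≤ _ := pow_le_pow_left₀ zero_le key 2
    _ = _ := by rw [mul_pow, hroot, hroot]

/-- A weighted Schur test for nonnegative kernels. -/
lemma lintegral_schur {X : Type*} [MeasurableSpace X] {ν : Measure X} [SFinite ν]
    {K : X → X → ℝ≥0∞} {p q w v h : X → ℝ≥0∞} {A B : ℝ≥0∞}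
    (hK : Measurable (Function.uncurry K)) (hp : Measurable p) (hq : Measurable q)
    (hw : Measurable w) (hv : Measurable v) (hh : Measurable h)
    (hA : ∀ᵐ z ∂ν, ∫⁻ y, K z y * p y ∂ν ≤ A * q z)
    (hB : ∀ᵐ y ∂ν, ∫⁻ z, K z y * (w z * q z) ∂ν ≤ B * v y) :
    ∫⁻ z, w z * (∫⁻ y, K z y * p y * h y ∂ν) ^ 2 ∂ν ≤ A * B * ∫⁻ y, p y * h y ^ 2 * v y ∂ν := by
  have hK1 (z : X) : Measurable (K z) := hK.of_uncurry_left
  have hK2 : Measurable fun x : X × X => K x.1 x.2 := hK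
  have hK3 (y : X) : Measurable fun z => K z y := hK.of_uncurry_right
  calc ∫⁻ z, w z * (∫⁻ y, K z y * p y * h y ∂ν) ^ 2 ∂ν
      ≤ ∫⁻ z, A * ∫⁻ y, K z y * (w z * q z) * (p y * h y ^ 2) ∂ν ∂ν := by
        refine lintegral_mono_ae ?_
        filter_upwards [hA] with z hz
        calc w z * (∫⁻ y, K z y * p y * h y ∂ν) ^ 2
            ≤ w z * ((A * q z) * ∫⁻ y, K z y * p y * h y ^ 2 ∂ν) := by
              gcongr
              exact (sq_lintegral_mul_le (F := fun y => K z y * p y) ((hK1 z).mul hp) hh).trans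
                (by gcongr)
          _ = A * ((w z * q z) * ∫⁻ y, K z y * p y * h y ^ 2 ∂ν) := by ring
          _ = _ := by
              have := hK1 z
              rw [← lintegral_const_mul _ (by fun_prop)]
              congr 1
              refine lintegral_congr fun y => ?_
              ring
    _ = A * ∫⁻ z, ∫⁻ y, K z y * (w z * q z) * (p y * h y ^ 2) ∂ν ∂ν := by
        refine lintegral_const_mul _ (Measurable.lintegral_prod_right' (f := fun x : X × X =>
          K x.1 x.2 * (w x.1 * q x.1) * (p x.2 * h x.2 ^ 2)) (by fun_prop))
    _ = A * ∫⁻ y, ∫⁻ z, K z y * (w z * q z) * (p y * h y ^ 2) ∂ν ∂ν := by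
        rw [lintegral_lintegral_swap]
        exact Measurable.aemeasurable (f := fun x : X × X =>
          K x.1 x.2 * (w x.1 * q x.1) * (p x.2 * h x.2 ^ 2)) (by fun_prop)
    _ ≤ A * ∫⁻ y, B * (p y * h y ^ 2 * v y) ∂ν := by
        gcongr A * ?_
        refine lintegral_mono_ae ?_
        filter_upwards [hB] with y hy
        have := hK3 y
        rw [lintegral_mul_const _ (by fun_prop)]
        calc _ ≤ B * v y * (p y * h y ^ 2) := by gcongr
          _ = _ := by ring
    _ = _ := by rw [lintegral_const_mul _ (by fun_prop), mul_assoc]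

lemma lintegral_rpow_hardy_near {X : Type*} [MeasurableSpace X] {C n c s : ℝ} (α : ℝ)
    (hC : 0 ≤ C) (hc : 0 < c) (hs : 0 < s) :
    ∃ K : ℝ≥0, ∀ (ν : Measure X) [SFinite ν] (d : X → ℝ), HasSublevelGrowth ν d C n →
      ∀ g : X → ℝ≥0∞, Measurable g →
      ∫⁻ z, ENNReal.ofReal (d z ^ (-n - 2 * s)) *
        (∫⁻ y in {y | d y < c * d z}, ENNReal.ofReal (d y ^ (α - n)) * g y ∂ν) ^ 2 ∂ν ≤
      K * ∫⁻ y, ENNReal.ofReal (d y ^ (-n + 2 * α - 2 * s)) * g y ^ 2 ∂ν := by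
  obtain ⟨K₁, hK₁⟩ := exists_setLIntegral_rpow_lt_le X (n := n) hC hs
  obtain ⟨K₂, hK₂⟩ := exists_setLIntegral_rpow_gt_le X (n := n) hC hs
  refine ⟨(K₁ * (c ^ s).toNNReal) * (K₂ * (c⁻¹ ^ (-s)).toNNReal), fun ν _ d h g hg => ?_⟩
  have hd := h.measurable
  have hms (z : X) : MeasurableSet {y | d y < c * d z} := measurableSet_lt hd measurable_const
  have hms' (z : X) : MeasurableSet {y | c⁻¹ * d z < d y} := measurableSet_lt measurable_const hd
  have key := lintegral_schur (ν := ν) (K := fun z y => if d y < c * d z then 1 else 0)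
    (p := fun y => ENNReal.ofReal (d y ^ (s - n))) (q := fun z => ENNReal.ofReal (d z ^ s))
    (w := fun z => ENNReal.ofReal (d z ^ (-n - 2 * s)))
    (v := fun y => ENNReal.ofReal (d y ^ (-s)))
    (h := fun y => ENNReal.ofReal (d y ^ (α - s)) * g y)
    (A := K₁ * (c ^ s).toNNReal) (B := K₂ * (c⁻¹ ^ (-s)).toNNReal)
    (Measurable.ite (measurableSet_lt (by fun_prop) (by fun_prop)) measurable_const
      measurable_const)
    (by fun_prop) (by fun_prop) (by fun_prop) (by fun_prop) (by fun_prop) ?_ ?_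
  · push_cast
    refine (le_of_eq ?_).trans (key.trans (le_of_eq ?_))
    · refine lintegral_congr fun z => ?_
      congr 2
      rw [← lintegral_indicator (hms z)]
      refine lintegral_congr_ae ?_
      filter_upwards [h.ae_pos] with y hy
      by_cases hyz : d y < c * d z
      · simp only [Set.indicator, Set.mem_ofPred_eq, hyz, if_true, one_mul]
        rw [← mul_assoc, ← ENNReal.ofReal_mul (by positivity), ← Real.rpow_add hy]
        congr 3
        ring
      · simp [Set.indicator, hyz]
    · congr 1
      refine lintegral_congr_ae ?_
      filter_upwards [h.ae_pos] with y hy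
      have e : d y ^ (-n + 2 * α - 2 * s) =
          d y ^ (s - n) * (d y ^ (α - s) * d y ^ (α - s)) * d y ^ (-s) := by
        rw [← Real.rpow_add hy, ← Real.rpow_add hy, ← Real.rpow_add hy]
        congr 1
        ring
      rw [e, ENNReal.ofReal_mul (by positivity), ENNReal.ofReal_mul (by positivity),
        ENNReal.ofReal_mul (by positivity)]
      ring
  · filter_upwards [h.ae_pos] with z hz
    have := hK₁ ν d h (c * d z) (by positivity)
    rw [← lintegral_indicator (hms z), Real.mul_rpow hc.le hz.le,
      ENNReal.ofReal_mul (by positivity), ← mul_assoc] at this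
    refine (le_of_eq ?_).trans this
    refine lintegral_congr fun y => ?_
    by_cases hyz : d y < c * d z <;> simp [Set.indicator, hyz]
  · filter_upwards [h.ae_pos] with y hy
    have := hK₂ ν d h (c⁻¹ * d y) (by positivity)
    rw [← lintegral_indicator (hms' y), Real.mul_rpow (by positivity) hy.le,
      ENNReal.ofReal_mul (by positivity), ← mul_assoc] at this
    refine (le_of_eq ?_).trans this
    refine lintegral_congr_ae ?_
    filter_upwards [h.ae_pos] with z hz
    have hiff : c⁻¹ * d y < d z ↔ d y < c * d z := inv_mul_lt_iff₀ hc
    by_cases hyz : d y < c * d z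
    · simp only [Set.indicator, Set.mem_ofPred_eq, hiff, hyz, if_true, one_mul]
      rw [← ENNReal.ofReal_mul (by positivity), ← Real.rpow_add hz]
      congr 2
      ring
    · simp [Set.indicator, hiff, hyz]

lemma lintegral_rpow_hardy_far {X : Type*} [MeasurableSpace X] {C n c s γ : ℝ} (α : ℝ)
    (hC : 0 ≤ C) (hc : 0 < c) (hs : s < γ) :
    ∃ K : ℝ≥0, ∀ (ν : Measure X) [SFinite ν] (d : X → ℝ), HasSublevelGrowth ν d C n →
      ∀ g : X → ℝ≥0∞, Measurable g →
      ∫⁻ z, ENNReal.ofReal (d z ^ (-n - 2 * s)) * (ENNReal.ofReal (d z ^ γ) *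
        ∫⁻ y in {y | c * d z < d y}, ENNReal.ofReal (d y ^ (α - γ - n)) * g y ∂ν) ^ 2 ∂ν ≤
      K * ∫⁻ y, ENNReal.ofReal (d y ^ (-n + 2 * α - 2 * s)) * g y ^ 2 ∂ν := by
  obtain ⟨b, hb, hbs⟩ : ∃ b : ℝ, 0 < b ∧ s = γ - b := ⟨γ - s, by linarith, by ring⟩
  obtain ⟨K₁, hK₁⟩ := exists_setLIntegral_rpow_lt_le X (n := n) hC hb
  obtain ⟨K₂, hK₂⟩ := exists_setLIntegral_rpow_gt_le X (n := n) hC hb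
  refine ⟨(K₂ * (c ^ (-b)).toNNReal) * (K₁ * (c⁻¹ ^ b).toNNReal), fun ν _ d h g hg => ?_⟩
  have hd := h.measurable
  have hms (z : X) : MeasurableSet {y | c * d z < d y} := measurableSet_lt measurable_const hd
  have hms' (z : X) : MeasurableSet {y | d y < c⁻¹ * d z} := measurableSet_lt hd measurable_const
  have key := lintegral_schur (ν := ν) (K := fun z y => if c * d z < d y then 1 else 0)
    (p := fun y => ENNReal.ofReal (d y ^ (-b - n))) (q := fun z => ENNReal.ofReal (d z ^ (-b)))
    (w := fun z => ENNReal.ofReal (d z ^ (-n - 2 * s + 2 * γ)))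
    (v := fun y => ENNReal.ofReal (d y ^ b))
    (h := fun y => ENNReal.ofReal (d y ^ (α - γ + b)) * g y)
    (A := K₂ * (c ^ (-b)).toNNReal) (B := K₁ * (c⁻¹ ^ b).toNNReal)
    (Measurable.ite (measurableSet_lt (by fun_prop) (by fun_prop)) measurable_const
      measurable_const)
    (by fun_prop) (by fun_prop) (by fun_prop) (by fun_prop) (by fun_prop) ?_ ?_
  · push_cast
    refine (le_of_eq ?_).trans (key.trans (le_of_eq ?_))
    · refine lintegral_congr_ae ?_
      filter_upwards [h.ae_pos] with z hz
      have e : d z ^ (-n - 2 * s + 2 * γ) = d z ^ (-n - 2 * s) * (d z ^ γ * d z ^ γ) := by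
        rw [← Real.rpow_add hz, ← Real.rpow_add hz]
        congr 1
        ring
      rw [e, ENNReal.ofReal_mul (by positivity), ENNReal.ofReal_mul (by positivity), mul_pow,
        ← pow_two, ← mul_assoc]
      congr 2
      rw [← lintegral_indicator (hms z)]
      refine lintegral_congr_ae ?_
      filter_upwards [h.ae_pos] with y hy
      by_cases hyz : c * d z < d y
      · simp only [Set.indicator, Set.mem_ofPred_eq, hyz, if_true, one_mul]
        rw [← mul_assoc, ← ENNReal.ofReal_mul (by positivity), ← Real.rpow_add hy]
        congr 3
        ring
      · simp [Set.indicator, hyz]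
    · congr 1
      refine lintegral_congr_ae ?_
      filter_upwards [h.ae_pos] with y hy
      have e : d y ^ (-n + 2 * α - 2 * s) =
          d y ^ (-b - n) * (d y ^ (α - γ + b) * d y ^ (α - γ + b)) * d y ^ b := by
        rw [← Real.rpow_add hy, ← Real.rpow_add hy, ← Real.rpow_add hy, hbs]
        congr 1
        ring
      rw [e, ENNReal.ofReal_mul (by positivity), ENNReal.ofReal_mul (by positivity),
        ENNReal.ofReal_mul (by positivity)]
      ring
  · filter_upwards [h.ae_pos] with z hz
    have := hK₂ ν d h (c * d z) (by positivity)
    rw [← lintegral_indicator (hms z), Real.mul_rpow hc.le hz.le,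
      ENNReal.ofReal_mul (by positivity), ← mul_assoc] at this
    refine (le_of_eq ?_).trans this
    refine lintegral_congr fun y => ?_
    by_cases hyz : c * d z < d y <;> simp [Set.indicator, hyz]
  · filter_upwards [h.ae_pos] with y hy
    have := hK₁ ν d h (c⁻¹ * d y) (by positivity)
    rw [← lintegral_indicator (hms' y), Real.mul_rpow (by positivity) hy.le,
      ENNReal.ofReal_mul (by positivity), ← mul_assoc] at this
    refine (le_of_eq ?_).trans this
    refine lintegral_congr_ae ?_
    filter_upwards [h.ae_pos] with z hz
    have hiff : d z < c⁻¹ * d y ↔ c * d z < d y := lt_inv_mul_iff₀ hc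
    by_cases hyz : c * d z < d y
    · simp only [Set.indicator, Set.mem_ofPred_eq, hiff, hyz, if_true, one_mul]
      rw [← ENNReal.ofReal_mul (by positivity), ← Real.rpow_add hz, hbs]
      congr 2
      ring
    · simp [Set.indicator, hiff, hyz]

lemma ENNReal.add_sq_le_two_mul (a b : ℝ≥0∞) : (a + b) ^ 2 ≤ 2 * a ^ 2 + 2 * b ^ 2 := by
  rcases eq_or_ne a ⊤ with rfl | ha
  · simp
  rcases eq_or_ne b ⊤ with rfl | hb
  · simp
  lift a to ℝ≥0 using ha
  lift b to ℝ≥0 using hb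
  have : (a + b) ^ 2 ≤ 2 * a ^ 2 + 2 * b ^ 2 := by
    rw [← mul_add]
    exact add_sq_le
  exact_mod_cast this

lemma ENNReal.sq_mul_add_four_le (A a b c d : ℝ≥0∞) :
    (A * (a + (b + d) + c)) ^ 2 ≤ 4 * A ^ 2 * (a ^ 2 + b ^ 2 + c ^ 2 + d ^ 2) := by
  have h : (a + (b + d) + c) ^ 2 ≤ 4 * (a ^ 2 + b ^ 2 + c ^ 2 + d ^ 2) := by
    calc (a + (b + d) + c) ^ 2 = ((a + c) + (b + d)) ^ 2 := by ring
      _ ≤ 2 * (a + c) ^ 2 + 2 * (b + d) ^ 2 := ENNReal.add_sq_le_two_mul _ _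
      _ ≤ 2 * (2 * a ^ 2 + 2 * c ^ 2) + 2 * (2 * b ^ 2 + 2 * d ^ 2) := by
          gcongr <;> exact ENNReal.add_sq_le_two_mul _ _
      _ = _ := by ring
  calc _ = A ^ 2 * (a + (b + d) + c) ^ 2 := mul_pow _ _ _
    _ ≤ A ^ 2 * (4 * (a ^ 2 + b ^ 2 + c ^ 2 + d ^ 2)) := by gcongr
    _ = _ := by ring

section Riesz

variable {E : Type*} [NormedAddCommGroup E] [MeasurableSpace E] {μ : Measure E} {S : Set E}
  {C n α γ s R : ℝ}

lemma exists_lintegral_riesz_le (hC : 0 ≤ C) (hα : 0 < α) (hR : 0 < R)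
    (hSR : ∀ x ∈ S, ∀ y ∈ S, ‖x - y‖ < R) (hμS : ∀ᵐ x ∂μ, x ∈ S)
    (hd : ∀ x ∈ S, HasSublevelGrowth μ (fun y => ‖x - y‖) C n) :
    ∃ K : ℝ≥0, ∀ x ∈ S, ∫⁻ y, ENNReal.ofReal (‖x - y‖ ^ (α - n)) ∂μ ≤ K := by
  obtain ⟨K, hK⟩ := exists_setLIntegral_rpow_lt_le E (n := n) hC hα
  refine ⟨K * (R ^ α).toNNReal, fun x hx => ?_⟩
  refine (le_of_eq ?_).trans ((hK μ _ (hd x hx) R hR).trans (le_of_eq (by simp [ENNReal.ofReal])))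
  rw [Measure.restrict_eq_self_of_ae_mem]
  filter_upwards [hμS] with y hy
  exact hSR x hx y hy

variable [BorelSpace E]

/-- Splitting `∫ |T(x,y) - T(z,y)| g(y)` into the parts near and away from `{x, z}`. -/
lemma lintegral_kernel_sub_le {T : E → E → ℝ} {A : ℝ≥0} {x z : E} {g : E → ℝ≥0∞}
    (hg : Measurable g)
    (hx : ∀ᵐ y ∂μ, ‖T x y‖ₑ ≤ A * ENNReal.ofReal (‖x - y‖ ^ (α - n)))
    (hz : ∀ᵐ y ∂μ, ‖T z y‖ₑ ≤ A * ENNReal.ofReal (‖z - y‖ ^ (α - n)))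
    (hxz : ∀ᵐ y ∂μ, 2 * ‖x - z‖ < ‖x - y‖ → ‖T x y - T z y‖ₑ ≤
      A * (ENNReal.ofReal (‖x - z‖ ^ γ) * ENNReal.ofReal (‖x - y‖ ^ (α - γ - n))))
    (hne : x ≠ z) :
    ∫⁻ y, ‖T x y - T z y‖ₑ * g y ∂μ ≤
      A * ((∫⁻ y in {y | ‖x - y‖ < 4 * ‖x - z‖}, ENNReal.ofReal (‖x - y‖ ^ (α - n)) * g y ∂μ) +
        (∫⁻ y in {y | ‖z - y‖ < 4 * ‖x - z‖}, ENNReal.ofReal (‖z - y‖ ^ (α - n)) * g y ∂μ) +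
        ENNReal.ofReal (‖x - z‖ ^ γ) * ∫⁻ y in {y | 2 * ‖x - z‖ < ‖x - y‖},
          ENNReal.ofReal (‖x - y‖ ^ (α - γ - n)) * g y ∂μ) := by
  have h1 : MeasurableSet {y | ‖x - y‖ < 4 * ‖x - z‖} :=
    measurableSet_lt (by fun_prop) (by fun_prop)
  have h2 : MeasurableSet {y | ‖z - y‖ < 4 * ‖x - z‖} :=
    measurableSet_lt (by fun_prop) (by fun_prop)
  have h3 : MeasurableSet {y | 2 * ‖x - z‖ < ‖x - y‖} :=
    measurableSet_lt (by fun_prop) (by fun_prop)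
  have hpos : 0 < ‖x - z‖ := norm_pos_iff.2 (sub_ne_zero.2 hne)
  rw [← lintegral_const_mul _ (by fun_prop), ← lintegral_indicator h1, ← lintegral_indicator h2,
    ← lintegral_indicator h3, ← lintegral_add_left (Measurable.indicator (by fun_prop) h1),
    ← lintegral_add_right _ (Measurable.indicator (by fun_prop) h3),
    ← lintegral_const_mul' _ _ ENNReal.coe_ne_top]
  refine lintegral_mono_ae ?_
  filter_upwards [hx, hz, hxz] with y hxy hzy hxzy
  by_cases hy : 2 * ‖x - z‖ < ‖x - y‖
  · calc ‖T x y - T z y‖ₑ * g y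
        ≤ A * (ENNReal.ofReal (‖x - z‖ ^ γ) * ENNReal.ofReal (‖x - y‖ ^ (α - γ - n))) * g y := by
          gcongr
          exact hxzy hy
      _ = A * (ENNReal.ofReal (‖x - z‖ ^ γ) *
            (ENNReal.ofReal (‖x - y‖ ^ (α - γ - n)) * g y)) := by ring
      _ ≤ _ := by
          refine mul_le_mul' le_rfl (le_trans (le_of_eq ?_) le_add_self)
          simp [Set.indicator, hy]
  · have hx4 : ‖x - y‖ < 4 * ‖x - z‖ := by linarith
    have hz4 : ‖z - y‖ < 4 * ‖x - z‖ := by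
      have := norm_sub_le_norm_sub_add_norm_sub z x y
      rw [norm_sub_rev z x] at this
      linarith
    calc ‖T x y - T z y‖ₑ * g y
        ≤ (A * ENNReal.ofReal (‖x - y‖ ^ (α - n)) + A * ENNReal.ofReal (‖z - y‖ ^ (α - n))) *
            g y := by
          gcongr
          exact enorm_sub_le.trans (add_le_add hxy hzy)
      _ = A * (ENNReal.ofReal (‖x - y‖ ^ (α - n)) * g y +
            ENNReal.ofReal (‖z - y‖ ^ (α - n)) * g y) := by ring
      _ ≤ _ := by
          refine mul_le_mul' le_rfl (le_trans (le_of_eq ?_) le_self_add)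
          simp [Set.indicator, hx4, hz4]

variable [SecondCountableTopology E] [IsFiniteMeasure μ]

lemma exists_lintegral_sq_riesz_le (hC : 0 ≤ C) (hα : 0 < α) (hR : 0 < R)
    (hSR : ∀ x ∈ S, ∀ y ∈ S, ‖x - y‖ < R) (hμS : ∀ᵐ x ∂μ, x ∈ S)
    (hd : ∀ x ∈ S, HasSublevelGrowth μ (fun y => ‖x - y‖) C n) :
    ∃ K : ℝ≥0, ∀ g : E → ℝ≥0∞, Measurable g →
      ∫⁻ x, (∫⁻ y, ENNReal.ofReal (‖x - y‖ ^ (α - n)) * g y ∂μ) ^ 2 ∂μ ≤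
        K * ∫⁻ y, g y ^ 2 ∂μ := by
  obtain ⟨K, hK⟩ := exists_lintegral_riesz_le hC hα hR hSR hμS hd
  refine ⟨K * K, fun g hg => ?_⟩
  have key := lintegral_schur (ν := μ) (K := fun x y => ENNReal.ofReal (‖x - y‖ ^ (α - n)))
    (p := fun _ => 1) (q := fun _ => 1) (w := fun _ => 1) (v := fun _ => 1) (h := g)
    (A := K) (B := K) (by unfold Function.uncurry; fun_prop) (by fun_prop) (by fun_prop)
    (by fun_prop) (by fun_prop) hg ?_ ?_
  · simpa using key
  · filter_upwards [hμS] with x hx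
    simpa using hK x hx
  · filter_upwards [hμS] with x hx
    simpa [norm_sub_rev] using hK x hx

set_option maxHeartbeats 800000 in
/-- If the increments of `u` are controlled by the increments of the kernel `T` tested against
`|φ(y) - c(x)|`, then the Gagliardo seminorm of `u` of order `s` is controlled by weighted
integrals of order `s - α` of `|φ(y) - c(x)|` and `|c(x) - c(y)|`. -/
lemma exists_gagliardo_le (hC : 0 ≤ C) (hα : 0 < α) (hs : 0 < s) (hsγ : s < γ)
    (hμS : ∀ᵐ x ∂μ, x ∈ S)
    (hd : ∀ x ∈ S, HasSublevelGrowth μ (fun y => ‖x - y‖) C n)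
    {T : E → E → ℝ} {A : ℝ≥0}
    (hT0 : ∀ x ∈ S, ∀ y ∈ S, x ≠ y → ‖T x y‖ₑ ≤ A * ENNReal.ofReal (‖x - y‖ ^ (α - n)))
    (hT1 : ∀ x ∈ S, ∀ z ∈ S, ∀ y ∈ S, 2 * ‖x - z‖ < ‖x - y‖ → ‖T x y - T z y‖ₑ ≤
      A * (ENNReal.ofReal (‖x - z‖ ^ γ) * ENNReal.ofReal (‖x - y‖ ^ (α - γ - n)))) :
    ∃ K : ℝ≥0, ∀ u φ c : E → ℝ, Measurable φ → Measurable c →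
      (∀ᵐ x ∂μ, ∀ᵐ z ∂μ, ‖u x - u z‖ₑ ≤ ∫⁻ y, ‖T x y - T z y‖ₑ * ‖φ y - c x‖ₑ ∂μ) →
      ∫⁻ x, ∫⁻ z, ENNReal.ofReal (‖x - z‖ ^ (-n - 2 * s)) * ‖u x - u z‖ₑ ^ 2 ∂μ ∂μ ≤
        K * ((∫⁻ x, ∫⁻ y, ENNReal.ofReal (‖x - y‖ ^ (-n + 2 * α - 2 * s)) *
            ‖φ y - c x‖ₑ ^ 2 ∂μ ∂μ) +
          ∫⁻ x, ∫⁻ y, ENNReal.ofReal (‖x - y‖ ^ (-n + 2 * α - 2 * s)) *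
            ‖c x - c y‖ₑ ^ 2 ∂μ ∂μ) := by
  obtain ⟨K₁, hK₁⟩ := lintegral_rpow_hardy_near (X := E) (n := n) (c := 4) α hC (by norm_num) hs
  obtain ⟨K₂, hK₂⟩ := lintegral_rpow_hardy_far (X := E) (n := n) (c := 2) α hC (by norm_num) hsγ
  obtain ⟨K₃, hK₃⟩ := exists_setLIntegral_rpow_lt_le E (n := n) hC hα
  set M : ℝ≥0 := K₃ * ((4 : ℝ) ^ α).toNNReal with hM
  refine ⟨4 * A ^ 2 * (K₁ + K₁ + K₂ + M ^ 2), fun u φ c hφ hc hu => ?_⟩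
  set N : E → E → ℝ≥0∞ := fun x z => ∫⁻ y in {y | ‖x - y‖ < 4 * ‖x - z‖},
    ENNReal.ofReal (‖x - y‖ ^ (α - n)) * ‖φ y - c x‖ₑ ∂μ with hN
  set F : E → E → ℝ≥0∞ := fun x z => ENNReal.ofReal (‖x - z‖ ^ γ) *
    ∫⁻ y in {y | 2 * ‖x - z‖ < ‖x - y‖},
    ENNReal.ofReal (‖x - y‖ ^ (α - γ - n)) * ‖φ y - c x‖ₑ ∂μ with hF
  set D : E → E → ℝ≥0∞ := fun x z => M * (ENNReal.ofReal (‖x - z‖ ^ α) * ‖c x - c z‖ₑ) with hD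
  set w : E → E → ℝ≥0∞ := fun x z => ENNReal.ofReal (‖x - z‖ ^ (-n - 2 * s)) with hw
  set J₁ := ∫⁻ x, ∫⁻ y, ENNReal.ofReal (‖x - y‖ ^ (-n + 2 * α - 2 * s)) *
    ‖φ y - c x‖ₑ ^ 2 ∂μ ∂μ with hJ₁
  set J₂ := ∫⁻ x, ∫⁻ y, ENNReal.ofReal (‖x - y‖ ^ (-n + 2 * α - 2 * s)) *
    ‖c x - c y‖ₑ ^ 2 ∂μ ∂μ with hJ₂
  have hwm : Measurable fun p : E × E => w p.1 p.2 := by fun_prop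
  have hNm : Measurable fun p : E × E => N p.1 p.2 := by
    have : (fun p : E × E => N p.1 p.2) = fun p : E × E => ∫⁻ y,
        if ‖p.1 - y‖ < 4 * ‖p.1 - p.2‖ then
          ENNReal.ofReal (‖p.1 - y‖ ^ (α - n)) * ‖φ y - c p.1‖ₑ else 0 ∂μ := by
      funext p
      simp only [hN]
      rw [← lintegral_indicator (measurableSet_lt (by fun_prop) (by fun_prop))]
      rfl
    rw [this]
    refine Measurable.lintegral_prod_right' (f := fun q : (E × E) × E =>
      if ‖q.1.1 - q.2‖ < 4 * ‖q.1.1 - q.1.2‖ then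
          ENNReal.ofReal (‖q.1.1 - q.2‖ ^ (α - n)) * ‖φ q.2 - c q.1.1‖ₑ else 0) ?_
    exact Measurable.ite (measurableSet_lt (by fun_prop) (by fun_prop)) (by fun_prop)
      measurable_const
  have hFm : Measurable fun p : E × E => F p.1 p.2 := by
    have : (fun p : E × E => F p.1 p.2) = fun p : E × E => ENNReal.ofReal (‖p.1 - p.2‖ ^ γ) * ∫⁻ y,
        if 2 * ‖p.1 - p.2‖ < ‖p.1 - y‖ then
          ENNReal.ofReal (‖p.1 - y‖ ^ (α - γ - n)) * ‖φ y - c p.1‖ₑ else 0 ∂μ := by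
      funext p
      simp only [hF]
      rw [← lintegral_indicator (measurableSet_lt (by fun_prop) (by fun_prop))]
      rfl
    rw [this]
    refine Measurable.mul (by fun_prop) (Measurable.lintegral_prod_right'
      (f := fun q : (E × E) × E => if 2 * ‖q.1.1 - q.1.2‖ < ‖q.1.1 - q.2‖ then
          ENNReal.ofReal (‖q.1.1 - q.2‖ ^ (α - γ - n)) * ‖φ q.2 - c q.1.1‖ₑ else 0) ?_)
    exact Measurable.ite (measurableSet_lt (by fun_prop) (by fun_prop)) (by fun_prop)
      measurable_const
  have hDm : Measurable fun p : E × E => D p.1 p.2 := by fun_prop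
  have hpoint : ∀ᵐ x ∂μ, ∀ᵐ z ∂μ, w x z * ‖u x - u z‖ₑ ^ 2 ≤
      4 * A ^ 2 * (w x z * N x z ^ 2 + w x z * N z x ^ 2 + w x z * F x z ^ 2 +
        w x z * D x z ^ 2) := by
    filter_upwards [hu, hμS] with x hux hx
    filter_upwards [hux, hμS, (hd x hx).ae_pos] with z huxz hz hpos
    have hne : x ≠ z := fun h => by simp [h] at hpos
    have hk (x : E) (hx : x ∈ S) :
        ∀ᵐ y ∂μ, ‖T x y‖ₑ ≤ A * ENNReal.ofReal (‖x - y‖ ^ (α - n)) := by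
      filter_upwards [hμS, (hd x hx).ae_pos] with y hy hxy
      exact hT0 x hx y hy fun h => by simp [h] at hxy
    have hsplit := lintegral_kernel_sub_le (γ := γ) (g := fun y => ‖φ y - c x‖ₑ) (by fun_prop)
      (hk x hx) (hk z hz) (by
        filter_upwards [hμS] with y hy
        exact hT1 x hx z hz y hy) hne
    have hmid : ∫⁻ y in {y | ‖z - y‖ < 4 * ‖x - z‖},
        ENNReal.ofReal (‖z - y‖ ^ (α - n)) * ‖φ y - c x‖ₑ ∂μ ≤ N z x + D x z := by
      have hb := hK₃ μ _ (hd z hz) (4 * ‖x - z‖) (by positivity)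
      rw [Real.mul_rpow (by norm_num) hpos.le, ENNReal.ofReal_mul (by positivity),
        ← mul_assoc] at hb
      calc _ ≤ ∫⁻ y in {y | ‖z - y‖ < 4 * ‖x - z‖},
            (ENNReal.ofReal (‖z - y‖ ^ (α - n)) * ‖φ y - c z‖ₑ +
              ENNReal.ofReal (‖z - y‖ ^ (α - n)) * ‖c x - c z‖ₑ) ∂μ := by
            refine lintegral_mono fun y => ?_
            rw [← mul_add]
            gcongr
            have : φ y - c x = (φ y - c z) - (c x - c z) := by ring
            rw [this]
            exact enorm_sub_le
        _ = N z x + (∫⁻ y in {y | ‖z - y‖ < 4 * ‖x - z‖},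
              ENNReal.ofReal (‖z - y‖ ^ (α - n)) ∂μ) * ‖c x - c z‖ₑ := by
            rw [lintegral_add_left (by fun_prop), lintegral_mul_const _ (by fun_prop)]
            simp only [hN]
            rw [norm_sub_rev z x]
        _ ≤ _ := by
            gcongr
            refine (mul_le_mul_left hb _).trans (le_of_eq ?_)
            simp only [hD, hM, ENNReal.coe_mul]
            rw [mul_assoc, ENNReal.ofReal]
    calc w x z * ‖u x - u z‖ₑ ^ 2
        ≤ w x z * (A * (N x z + (N z x + D x z) + F x z)) ^ 2 := by
          gcongr
          refine huxz.trans (hsplit.trans ?_)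
          gcongr
      _ ≤ w x z * (4 * A ^ 2 * (N x z ^ 2 + N z x ^ 2 + F x z ^ 2 + D x z ^ 2)) := by
          gcongr
          exact ENNReal.sq_mul_add_four_le _ _ _ _ _
      _ = _ := by ring
  have b1 : ∫⁻ x, ∫⁻ z, w x z * N x z ^ 2 ∂μ ∂μ ≤ K₁ * J₁ := by
    rw [hJ₁, ← lintegral_const_mul' _ _ ENNReal.coe_ne_top]
    refine lintegral_mono_ae ?_
    filter_upwards [hμS] with x hx
    exact hK₁ μ _ (hd x hx) (fun y => ‖φ y - c x‖ₑ) (by fun_prop)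
  have b2 : ∫⁻ x, ∫⁻ z, w x z * N z x ^ 2 ∂μ ∂μ ≤ K₁ * J₁ := by
    rw [lintegral_lintegral_swap]
    · refine le_trans (le_of_eq ?_) b1
      simp only [hw]
      refine lintegral_congr fun x => lintegral_congr fun z => ?_
      rw [norm_sub_rev]
    · have : Measurable fun p : E × E => N p.2 p.1 := hNm.comp measurable_swap
      exact (hwm.mul (this.pow_const 2)).aemeasurable
  have b3 : ∫⁻ x, ∫⁻ z, w x z * F x z ^ 2 ∂μ ∂μ ≤ K₂ * J₁ := by
    rw [hJ₁, ← lintegral_const_mul' _ _ ENNReal.coe_ne_top]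
    refine lintegral_mono_ae ?_
    filter_upwards [hμS] with x hx
    exact hK₂ μ _ (hd x hx) (fun y => ‖φ y - c x‖ₑ) (by fun_prop)
  have b4 : ∫⁻ x, ∫⁻ z, w x z * D x z ^ 2 ∂μ ∂μ = (M : ℝ≥0∞) ^ 2 * J₂ := by
    rw [hJ₂, ← lintegral_const_mul' _ _ (by simp)]
    refine lintegral_congr_ae ?_
    filter_upwards [hμS] with x hx
    rw [← lintegral_const_mul' _ _ (by simp)]
    refine lintegral_congr_ae ?_
    filter_upwards [(hd x hx).ae_pos] with z hpos
    have e : ‖x - z‖ ^ (-n + 2 * α - 2 * s) =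
        ‖x - z‖ ^ (-n - 2 * s) * (‖x - z‖ ^ α * ‖x - z‖ ^ α) := by
      rw [← Real.rpow_add hpos, ← Real.rpow_add hpos]
      congr 1
      ring
    simp only [hw, hD]
    rw [e, ENNReal.ofReal_mul (by positivity), ENNReal.ofReal_mul (by positivity)]
    ring
  have hsec {f : E → E → ℝ≥0∞} (hf : Measurable fun p : E × E => f p.1 p.2) (x : E) :
      Measurable fun z => w x z * f x z ^ 2 :=
    (hwm.mul (hf.pow_const 2)).comp (measurable_const.prodMk measurable_id)
  have hint {f : E → E → ℝ≥0∞} (hf : Measurable fun p : E × E => f p.1 p.2) :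
      Measurable fun x => ∫⁻ z, w x z * f x z ^ 2 ∂μ :=
    Measurable.lintegral_prod_right' (f := fun p : E × E => w p.1 p.2 * f p.1 p.2 ^ 2)
      (hwm.mul (hf.pow_const 2))
  calc ∫⁻ x, ∫⁻ z, w x z * ‖u x - u z‖ₑ ^ 2 ∂μ ∂μ
      ≤ ∫⁻ x, ∫⁻ z, 4 * A ^ 2 * (w x z * N x z ^ 2 + w x z * N z x ^ 2 + w x z * F x z ^ 2 +
        w x z * D x z ^ 2) ∂μ ∂μ := by
        refine lintegral_mono_ae ?_
        filter_upwards [hpoint] with x hx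
        exact lintegral_mono_ae hx
    _ = 4 * A ^ 2 * ((∫⁻ x, ∫⁻ z, w x z * N x z ^ 2 ∂μ ∂μ) +
          (∫⁻ x, ∫⁻ z, w x z * N z x ^ 2 ∂μ ∂μ) + (∫⁻ x, ∫⁻ z, w x z * F x z ^ 2 ∂μ ∂μ) +
          ∫⁻ x, ∫⁻ z, w x z * D x z ^ 2 ∂μ ∂μ) := by
        have hfin : (4 * A ^ 2 : ℝ≥0∞) ≠ ⊤ := by finiteness
        rw [← lintegral_add_left (hint hNm), ← lintegral_add_right _ (hint hFm),
          ← lintegral_add_right _ (hint hDm), ← lintegral_const_mul' _ _ hfin]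
        refine lintegral_congr fun x => ?_
        rw [lintegral_const_mul' _ _ hfin, lintegral_add_right _ (hsec hDm x),
          lintegral_add_right _ (hsec hFm x), lintegral_add_left (hsec hNm x)]
    _ ≤ 4 * A ^ 2 * (K₁ * J₁ + K₁ * J₁ + K₂ * J₁ + (M : ℝ≥0∞) ^ 2 * J₂) := by
        rw [b4]
        gcongr
    _ ≤ 4 * A ^ 2 * ((K₁ + K₁ + K₂) * (J₁ + J₂) + (M : ℝ≥0∞) ^ 2 * (J₁ + J₂)) := by
        rw [← add_mul, ← add_mul]
        gcongr
        · exact le_self_add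
        · exact le_add_self
    _ = _ := by
        push_cast
        ring

end Riesz

lemma hsNormSq_eq {E : Type*} [NormedAddCommGroup E] [MeasurableSpace E]
    (m : ℕ) (σ : Measure E) (S : Set E) (s : ℝ) (φ : E → ℝ) :
    hsNormSq m σ S s φ = (∫⁻ x in S, ‖φ x‖ₑ ^ 2 ∂σ) + if s = 0 then 0 else
      ∫⁻ x in S, ∫⁻ y in S,
        ENNReal.ofReal (‖x - y‖ ^ (-((m : ℝ) - 1) - 2 * s)) * ‖φ x - φ y‖ₑ ^ 2 ∂σ ∂σ := by
  have h (a : ℝ) : ENNReal.ofReal (a ^ 2) = ‖a‖ₑ ^ 2 := by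
    rw [← sq_abs, ENNReal.ofReal_pow (abs_nonneg a), ← Real.norm_eq_abs, ofReal_norm]
  have h' (x y : E) :
      ENNReal.ofReal ((φ x - φ y) ^ 2 / ‖x - y‖ ^ ((m : ℝ) - 1 + 2 * s)) =
        ENNReal.ofReal (‖x - y‖ ^ (-((m : ℝ) - 1) - 2 * s)) * ‖φ x - φ y‖ₑ ^ 2 := by
    rw [← h, ← ENNReal.ofReal_mul (by positivity), div_eq_mul_inv,
      ← Real.rpow_neg (norm_nonneg _), mul_comm]
    congr 3
    ring
  simp only [hsNormSq, h, h']

lemma enorm_integral_kernel_sub_le {X : Type*} [MeasurableSpace X] {μ : Measure X}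
    {f g φ : X → ℝ} (hf : Integrable f μ) (hg : Integrable g μ)
    (hfφ : Integrable (fun y => f y * φ y) μ) (hgφ : Integrable (fun y => g y * φ y) μ)
    {c : ℝ} (hc : c * ((∫ y, f y ∂μ) - ∫ y, g y ∂μ) = 0) :
    ‖(∫ y, f y * φ y ∂μ) - ∫ y, g y * φ y ∂μ‖ₑ ≤ ∫⁻ y, ‖f y - g y‖ₑ * ‖φ y - c‖ₑ ∂μ := by
  have h1 : Integrable (fun y => f y * φ y - g y * φ y) μ := hfφ.sub hgφ
  have h2 : Integrable (fun y => c * (f y - g y)) μ := (hf.sub hg).const_mul c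
  have e : (∫ y, f y * φ y ∂μ) - ∫ y, g y * φ y ∂μ = ∫ y, (f y - g y) * (φ y - c) ∂μ := by
    calc (∫ y, f y * φ y ∂μ) - ∫ y, g y * φ y ∂μ
        = ((∫ y, f y * φ y ∂μ) - ∫ y, g y * φ y ∂μ) - c * ((∫ y, f y ∂μ) - ∫ y, g y ∂μ) := by
          rw [hc, sub_zero]
      _ = ∫ y, ((f y * φ y - g y * φ y) - c * (f y - g y)) ∂μ := by
          rw [integral_sub h1 h2, integral_sub hfφ hgφ,
            integral_const_mul, integral_sub hf hg]
      _ = _ := by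
          congr 1
          funext y
          ring
  rw [e]
  refine (enorm_integral_le_lintegral_enorm _).trans (le_of_eq ?_)
  simp only [enorm_mul]

/-- Under the kernel and measure hypotheses, if moreover
`x ↦ ∫_S T(x,y) dσ(y)` is constant on `S`, then for all `t, s` with `0 ≤ s < γ`,
`max {0, s − β − γ + 1} ≤ t` and `(t, s) ≠ (0, β + γ − 1)`, the integral operator
`Tφ(x) = ∫_S T(x,y) φ(y) dσ(y)` is bounded from `H^t(σ)` into `H^s(σ)`. -/
theorem integral_operator_Ht_to_Hs
    (m : ℕ) (hm : 2 ≤ m)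
    (σ : Measure (EuclideanSpace ℝ (Fin m))) [IsFiniteMeasure σ]
    (S : Set (EuclideanSpace ℝ (Fin m))) (hScpt : IsCompact S) (hsupp : σ Sᶜ = 0)
    (C₀ : ℝ)
    (hgrowth : ∀ x ∈ S, ∀ r : ℝ, 0 < r →
      σ (Metric.ball x r) ≤ ENNReal.ofReal (C₀ * r ^ ((m : ℝ) - 1)))
    (T : EuclideanSpace ℝ (Fin m) → EuclideanSpace ℝ (Fin m) → ℝ)
    (hTmeas : Measurable (Function.uncurry T))
    (β γ C₁ : ℝ) (hγ0 : 0 < γ) (hγ1 : γ ≤ 1) (hβ : 0 < β) (hβγ : 1 < β + γ)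
    (hT0 : ∀ x ∈ S, ∀ y ∈ S, x ≠ y →
      |T x y| ≤ C₁ / ‖x - y‖ ^ ((m : ℝ) - β - γ))
    (hT1 : ∀ x ∈ S, ∀ z ∈ S, ∀ y ∈ S, 2 * ‖x - z‖ < ‖x - y‖ →
      |T x y - T z y| ≤ C₁ * ‖x - z‖ ^ γ / ‖x - y‖ ^ ((m : ℝ) - β))
    (hconst : ∃ c : ℝ, ∀ x ∈ S, (∫ y in S, T x y ∂σ) = c)
    (t s : ℝ) (hs0 : 0 ≤ s) (hsγ : s < γ)
    (ht : max 0 (s - β - γ + 1) ≤ t) (hts : (t, s) ≠ (0, β + γ - 1)) :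
    ∃ C : ℝ≥0, ∀ φ : EuclideanSpace ℝ (Fin m) → ℝ, Measurable φ →
      hsNormSq m σ S t φ < ⊤ →
      hsNormSq m σ S s (fun x => ∫ y in S, T x y * φ y ∂σ)
        ≤ (C : ℝ≥0∞) * hsNormSq m σ S t φ := by
  set μ := σ.restrict S with hμ
  set n : ℝ := (m : ℝ) - 1 with hn
  set α : ℝ := β + γ - 1 with hα_def
  have hα : 0 < α := by linarith
  have hm' : (2 : ℝ) ≤ m := by exact_mod_cast hm
  have hn0 : 0 < n := by linarith
  have hμS : ∀ᵐ x ∂μ, x ∈ S := ae_restrict_mem hScpt.measurableSet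
  obtain ⟨R, hR, hSR⟩ : ∃ R : ℝ, 0 < R ∧ ∀ x ∈ S, ∀ y ∈ S, ‖x - y‖ < R := by
    obtain ⟨D, hD⟩ := hScpt.isBounded.exists_norm_le
    refine ⟨2 * |D| + 1, by positivity, fun x hx y hy => ?_⟩
    have := norm_sub_le x y
    have := hD x hx
    have := hD y hy
    have := le_abs_self D
    linarith
  have hd : ∀ x ∈ S, HasSublevelGrowth μ (fun y => ‖x - y‖) |C₀| n := by
    intro x hx
    have hball (r : ℝ) (hr : 0 < r) : μ {y | ‖x - y‖ < r} ≤ ENNReal.ofReal (|C₀| * r ^ n) := by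
      have : {y | ‖x - y‖ < r} = Metric.ball x r := by
        ext y
        simp [dist_eq_norm, norm_sub_rev]
      rw [this]
      refine (Measure.restrict_apply_le _ _).trans ((hgrowth x hx r hr).trans ?_)
      gcongr
      exact le_abs_self _
    refine ⟨by fun_prop, ?_, hball⟩
    have hzero : μ {x} = 0 := by
      refine le_antisymm ?_ zero_le
      have hlim : Filter.Tendsto (fun r : ℝ => ENNReal.ofReal (|C₀| * r ^ n))
          (nhdsWithin 0 (Set.Ioi 0)) (nhds 0) := by
        have : Continuous fun r : ℝ => ENNReal.ofReal (|C₀| * r ^ n) :=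
          ENNReal.continuous_ofReal.comp
            (continuous_const.mul (Real.continuous_rpow_const hn0.le))
        have h0 := this.tendsto 0
        simp only [Real.zero_rpow hn0.ne', mul_zero, ENNReal.ofReal_zero] at h0
        exact h0.mono_left nhdsWithin_le_nhds
      refine ge_of_tendsto hlim ?_
      filter_upwards [self_mem_nhdsWithin] with r hr
      refine (measure_mono ?_).trans (hball r hr)
      simpa using hr
    have : ∀ᵐ y ∂μ, y ≠ x := by
      rw [ae_iff]
      simpa using hzero
    filter_upwards [this] with y hy
    exact norm_pos_iff.2 (sub_ne_zero.2 hy.symm)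
  set A : ℝ≥0 := |C₁|.toNNReal with hA
  have hAof : (A : ℝ≥0∞) = ENNReal.ofReal |C₁| := rfl
  have hT0' : ∀ x ∈ S, ∀ y ∈ S, x ≠ y →
      ‖T x y‖ₑ ≤ A * ENNReal.ofReal (‖x - y‖ ^ (α - n)) := by
    intro x hx y hy hxy
    rw [hAof, ← ENNReal.ofReal_mul (abs_nonneg _), ← ofReal_norm, Real.norm_eq_abs]
    refine ENNReal.ofReal_le_ofReal ((hT0 x hx y hy hxy).trans ?_)
    rw [div_eq_mul_inv, ← Real.rpow_neg (norm_nonneg _),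
      show -((m : ℝ) - β - γ) = α - n by rw [hn, hα_def]; ring]
    gcongr
    exact le_abs_self _
  have hT1' : ∀ x ∈ S, ∀ z ∈ S, ∀ y ∈ S, 2 * ‖x - z‖ < ‖x - y‖ → ‖T x y - T z y‖ₑ ≤
      A * (ENNReal.ofReal (‖x - z‖ ^ γ) * ENNReal.ofReal (‖x - y‖ ^ (α - γ - n))) := by
    intro x hx z hz y hy hxzy
    rw [hAof, ← ENNReal.ofReal_mul (by positivity), ← ENNReal.ofReal_mul (abs_nonneg _),
      ← ofReal_norm, Real.norm_eq_abs]
    refine ENNReal.ofReal_le_ofReal ((hT1 x hx z hz y hy hxzy).trans ?_)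
    rw [div_eq_mul_inv, ← Real.rpow_neg (norm_nonneg _),
      show -((m : ℝ) - β) = α - γ - n by rw [hn, hα_def]; ring, mul_assoc]
    gcongr
    exact le_abs_self _
  have hTae (x) (hx : x ∈ S) : ∀ᵐ y ∂μ, ‖T x y‖ₑ ≤ A * ENNReal.ofReal (‖x - y‖ ^ (α - n)) := by
    filter_upwards [hμS, (hd x hx).ae_pos] with y hy hxy
    exact hT0' x hx y hy fun h => by simp [h] at hxy
  have hTm (x) : Measurable (T x) := hTmeas.of_uncurry_left
  obtain ⟨K₀, hK₀⟩ := exists_lintegral_riesz_le (abs_nonneg C₀) hα hR hSR hμS hd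
  obtain ⟨K₁, hK₁⟩ := exists_lintegral_sq_riesz_le (abs_nonneg C₀) hα hR hSR hμS hd
  have hTint (x) (hx : x ∈ S) : Integrable (T x) μ := by
    refine ⟨(hTm x).aestronglyMeasurable, ?_⟩
    refine (lintegral_mono_ae (hTae x hx)).trans_lt ?_
    rw [lintegral_const_mul' _ _ ENNReal.coe_ne_top]
    exact ENNReal.mul_lt_top ENNReal.coe_lt_top ((hK₀ x hx).trans_lt ENNReal.coe_lt_top)
  have hTφ (φ : EuclideanSpace ℝ (Fin m) → ℝ) (x) (hx : x ∈ S) :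
      ∫⁻ y, ‖T x y * φ y‖ₑ ∂μ ≤
        A * ∫⁻ y, ENNReal.ofReal (‖x - y‖ ^ (α - n)) * ‖φ y‖ₑ ∂μ := by
    rw [← lintegral_const_mul' _ _ ENNReal.coe_ne_top]
    refine lintegral_mono_ae ?_
    filter_upwards [hTae x hx] with y hy
    rw [enorm_mul, ← mul_assoc]
    gcongr
  have hTφint (φ : EuclideanSpace ℝ (Fin m) → ℝ) (hφ : Measurable φ)
      (hφ2 : ∫⁻ y, ‖φ y‖ₑ ^ 2 ∂μ < ⊤) : ∀ᵐ x ∂μ, Integrable (fun y => T x y * φ y) μ := by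
    have hfin := (hK₁ (fun y => ‖φ y‖ₑ) (by fun_prop)).trans_lt
      (ENNReal.mul_lt_top ENNReal.coe_lt_top hφ2)
    have hmeas : Measurable fun x => (∫⁻ y, ENNReal.ofReal (‖x - y‖ ^ (α - n)) * ‖φ y‖ₑ ∂μ) ^ 2 :=
      (Measurable.lintegral_prod_right' (f := fun p : EuclideanSpace ℝ (Fin m) ×
        EuclideanSpace ℝ (Fin m) => ENNReal.ofReal (‖p.1 - p.2‖ ^ (α - n)) * ‖φ p.2‖ₑ)
        (by fun_prop)).pow_const 2
    filter_upwards [ae_lt_top hmeas hfin.ne, hμS] with x hx hxS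
    refine ⟨((hTm x).mul hφ).aestronglyMeasurable, (hTφ φ x hxS).trans_lt ?_⟩
    exact ENNReal.mul_lt_top ENNReal.coe_lt_top ((ENNReal.pow_lt_top_iff).1 hx |>.resolve_right
      (by norm_num))
  have hL2 (φ : EuclideanSpace ℝ (Fin m) → ℝ) (hφ : Measurable φ) :
      ∫⁻ x, ‖∫ y, T x y * φ y ∂μ‖ₑ ^ 2 ∂μ ≤ A ^ 2 * K₁ * ∫⁻ y, ‖φ y‖ₑ ^ 2 ∂μ := by
    rw [mul_assoc]
    refine le_trans ?_ (mul_le_mul' le_rfl (hK₁ (fun y => ‖φ y‖ₑ) (by fun_prop)))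
    rw [← lintegral_const_mul' _ _ (by finiteness)]
    refine lintegral_mono_ae ?_
    filter_upwards [hμS] with x hx
    rw [← mul_pow]
    gcongr
    exact (enorm_integral_le_lintegral_enorm _).trans (hTφ φ x hx)
  rcases hs0.eq_or_lt with rfl | hs
  · refine ⟨A ^ 2 * K₁, fun φ hφ _ => ?_⟩
    rw [hsNormSq_eq, hsNormSq_eq, if_pos rfl, add_zero]
    push_cast
    exact (hL2 φ hφ).trans (mul_le_mul' le_rfl le_self_add)
  obtain ⟨K₂, hK₂⟩ := exists_gagliardo_le (abs_nonneg C₀) hα hs hsγ hμS hd hT0' hT1'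
  suffices hsemi : ∃ L : ℝ≥0, ∀ φ : EuclideanSpace ℝ (Fin m) → ℝ, Measurable φ →
      hsNormSq m σ S t φ < ⊤ →
      ∫⁻ x, ∫⁻ z, ENNReal.ofReal (‖x - z‖ ^ (-n - 2 * s)) *
        ‖(∫ y, T x y * φ y ∂μ) - ∫ y, T z y * φ y ∂μ‖ₑ ^ 2 ∂μ ∂μ ≤
          L * hsNormSq m σ S t φ by
    obtain ⟨L, hL⟩ := hsemi
    refine ⟨A ^ 2 * K₁ + L, fun φ hφ hfin => ?_⟩
    have h1 : ∫⁻ x, ‖∫ y, T x y * φ y ∂μ‖ₑ ^ 2 ∂μ ≤ A ^ 2 * K₁ * hsNormSq m σ S t φ :=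
      (hL2 φ hφ).trans (mul_le_mul' le_rfl (by rw [hsNormSq_eq]; exact le_self_add))
    rw [hsNormSq_eq m σ S s, if_neg hs.ne']
    push_cast
    rw [add_mul]
    exact add_le_add h1 (hL φ hφ hfin)
  have hφ2 {φ : EuclideanSpace ℝ (Fin m) → ℝ} (h : hsNormSq m σ S t φ < ⊤) :
      ∫⁻ y, ‖φ y‖ₑ ^ 2 ∂μ < ⊤ := by
    rw [hsNormSq_eq] at h
    exact le_self_add.trans_lt h
  rcases lt_or_ge s α with hsα | hsα
  · obtain ⟨K₃, hK₃⟩ := exists_lintegral_riesz_le (α := 2 * (α - s)) (abs_nonneg C₀)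
      (by linarith) hR hSR hμS hd
    refine ⟨K₂ * K₃, fun φ hφ hfin => ?_⟩
    refine (hK₂ _ φ (fun _ => 0) hφ measurable_const ?_).trans ?_
    · filter_upwards [hTφint φ hφ (hφ2 hfin), hμS] with x hx hxS
      filter_upwards [hTφint φ hφ (hφ2 hfin), hμS] with z hz hzS
      exact enorm_integral_kernel_sub_le (hTint x hxS) (hTint z hzS) hx hz (by simp)
    · push_cast
      rw [mul_assoc]
      gcongr
      simp only [sub_zero, enorm_zero, ne_eq, OfNat.ofNat_ne_zero, not_false_eq_true, zero_pow,
        mul_zero, lintegral_zero, add_zero]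
      rw [lintegral_lintegral_swap (by unfold Function.uncurry; fun_prop)]
      calc _ ≤ ∫⁻ y, K₃ * ‖φ y‖ₑ ^ 2 ∂μ := by
            refine lintegral_mono_ae ?_
            filter_upwards [hμS] with y hy
            rw [lintegral_mul_const _ (by fun_prop)]
            gcongr
            refine le_trans (le_of_eq ?_) (hK₃ y hy)
            refine lintegral_congr fun x => ?_
            rw [norm_sub_rev]
            congr 2
            ring
        _ = K₃ * ∫⁻ y, ‖φ y‖ₑ ^ 2 ∂μ := lintegral_const_mul' _ _ ENNReal.coe_ne_top
        _ ≤ _ := by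
            gcongr
            rw [hsNormSq_eq]
            exact le_self_add
  · have ht' : s - α ≤ t := by
      have := (le_max_right _ _).trans ht
      rw [hα_def]
      linarith
    have ht0 : 0 < t := by
      refine lt_of_le_of_ne ((le_max_left _ _).trans ht) fun h => hts ?_
      rw [← h, Prod.mk.injEq]
      exact ⟨rfl, by linarith⟩
    set M : ℝ≥0 := (R ^ (2 * (t - (s - α)))).toNNReal with hM
    refine ⟨K₂ * (M + M), fun φ hφ hfin => ?_⟩
    obtain ⟨c₀, hc₀⟩ := hconst
    have hJ : ∫⁻ x, ∫⁻ y, ENNReal.ofReal (‖x - y‖ ^ (-n + 2 * α - 2 * s)) *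
        ‖φ x - φ y‖ₑ ^ 2 ∂μ ∂μ ≤ M * hsNormSq m σ S t φ := by
      rw [hsNormSq_eq, if_neg ht0.ne']
      refine le_trans ?_ (mul_le_mul' le_rfl le_add_self)
      rw [← lintegral_const_mul' _ _ ENNReal.coe_ne_top]
      refine lintegral_mono_ae ?_
      filter_upwards [hμS] with x hx
      rw [← lintegral_const_mul' _ _ ENNReal.coe_ne_top]
      refine lintegral_mono_ae ?_
      filter_upwards [hμS, (hd x hx).ae_pos] with y hy hpos
      rw [← mul_assoc]
      gcongr
      rw [hM, ← ENNReal.ofReal, ← ENNReal.ofReal_mul (by positivity)]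
      refine ENNReal.ofReal_le_ofReal ?_
      rw [show -n + 2 * α - 2 * s = 2 * (t - (s - α)) + (-n - 2 * t) by ring, Real.rpow_add hpos]
      gcongr
      exact (hSR x hx y hy).le
    refine (hK₂ _ φ φ hφ hφ ?_).trans ?_
    · filter_upwards [hTφint φ hφ (hφ2 hfin), hμS] with x hx hxS
      filter_upwards [hTφint φ hφ (hφ2 hfin), hμS] with z hz hzS
      refine enorm_integral_kernel_sub_le (hTint x hxS) (hTint z hzS) hx hz ?_
      rw [hc₀ x hxS, hc₀ z hzS, sub_self, mul_zero]
    · push_cast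
      rw [mul_assoc, add_mul]
      gcongr
      simp only [enorm_sub_rev (φ _) (φ _)] at hJ ⊢
      exact hJ
end
end

section
/- Let m ≥ 3, k ≥ 0 and let p : ℝ^m → ℝ^m be a vector field whose components are homogeneous polynomials of degree k. Define its Kelvin transform by p*(x) := |x|^{−(2k+m−2)} p(x) for x ≠ 0. If ∇·p(x) = 0 for all x in the open unit ball of ℝ^m and ∇·p*(x) = 0 for all x with |x| > 1, then ∇·p = 0 on all of ℝ^m and x·p(x) = 0 for every x ∈ ℝ^m. -/
noncomputable section

open scoped BigOperators

/-- The Euclidean inner product on `ℝ^m`. -/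
def dotm (m : ℕ) (x y : Fin m → ℝ) : ℝ := ∑ i, x i * y i

/-- The Euclidean norm on `ℝ^m`. -/
def normm (m : ℕ) (x : Fin m → ℝ) : ℝ := Real.sqrt (dotm m x x)

/-- Partial derivative in the `i`-th coordinate direction on `ℝ^m`. -/
def pdm (m : ℕ) (i : Fin m) (f : (Fin m → ℝ) → ℝ) (x : Fin m → ℝ) : ℝ :=
  fderiv ℝ f x (Pi.single i 1)

/-- Divergence of a vector field on `ℝ^m`. -/
def divm (m : ℕ) (p : (Fin m → ℝ) → (Fin m → ℝ)) (x : Fin m → ℝ) : ℝ :=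
  ∑ i, pdm m i (fun y => p y i) x

/-- `f` is the function of a homogeneous polynomial of degree `k` on `ℝ^m`. -/
def IsHomogPolym (m k : ℕ) (f : (Fin m → ℝ) → ℝ) : Prop :=
  ∃ q : MvPolynomial (Fin m) ℝ, q.IsHomogeneous k ∧ ∀ x, f x = MvPolynomial.eval x q

/-- Kelvin transform of a degree-`k` homogeneous field on `ℝ^m`:
`p*(x) = |x|^{-(2k+m-2)} p(x)`. -/
def kelvinm (m k : ℕ) (p : (Fin m → ℝ) → (Fin m → ℝ)) :
    (Fin m → ℝ) → (Fin m → ℝ) :=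
  fun x => (normm m x ^ (2 * k + m - 2))⁻¹ • p x

lemma MvPolynomial.IsHomogeneous.eval_smul {σ R : Type*} [Fintype σ] [CommSemiring R]
    {k : ℕ} {q : MvPolynomial σ R} (hq : q.IsHomogeneous k) (c : R) (x : σ → R) :
    MvPolynomial.eval (c • x) q = c ^ k * MvPolynomial.eval x q := by
  simp only [MvPolynomial.eval_eq', Finset.mul_sum]
  refine Finset.sum_congr rfl fun d hd => ?_
  have hdeg : ∑ i, d i = k := by
    rw [← Finsupp.degree_eq_sum]
    by_contra h
    exact MvPolynomial.mem_support_iff.1 hd (hq.coeff_eq_zero h)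
  simp only [Pi.smul_apply, smul_eq_mul, mul_pow, Finset.prod_mul_distrib,
    Finset.prod_pow_eq_pow_sum, hdeg]
  ring

lemma IsHomogPolym.differentiable {m k : ℕ} {f : (Fin m → ℝ) → ℝ} (hf : IsHomogPolym m k f) :
    Differentiable ℝ f := by
  obtain ⟨q, -, hq⟩ := hf
  rw [show f = fun x => MvPolynomial.eval x q from funext hq]
  exact fun x => (AnalyticOnNhd.eval_mvPolynomial q x (Set.mem_univ x)).differentiableAt

lemma IsHomogPolym.map_smul {m k : ℕ} {f : (Fin m → ℝ) → ℝ} (hf : IsHomogPolym m k f)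
    (c : ℝ) (x : Fin m → ℝ) : f (c • x) = c ^ k * f x := by
  obtain ⟨q, hhom, hq⟩ := hf
  rw [hq, hq, hhom.eval_smul]

lemma IsHomogPolym.mul_pdm_smul {m k : ℕ} {f : (Fin m → ℝ) → ℝ} (hf : IsHomogPolym m k f)
    (i : Fin m) (c : ℝ) (x : Fin m → ℝ) : c * pdm m i f (c • x) = c ^ k * pdm m i f x := by
  have h := congrArg (fun L => L (Pi.single i 1)) (fderiv_comp_smul (𝕜 := ℝ) (f := f) (x := x) c)
  rw [show (fun y => f (c • y)) = fun y => c ^ k * f y from funext (hf.map_smul c),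
    fderiv_const_mul (hf.differentiable x)] at h
  simpa [pdm] using h.symm

lemma mul_divm_smul {m k : ℕ} {p : (Fin m → ℝ) → (Fin m → ℝ)}
    (hp : ∀ i, IsHomogPolym m k (fun x => p x i)) (c : ℝ) (x : Fin m → ℝ) :
    c * divm m p (c • x) = c ^ k * divm m p x := by
  simp only [divm, Finset.mul_sum, (hp _).mul_pdm_smul]

lemma dotm_smul_apply_smul {m k : ℕ} {p : (Fin m → ℝ) → (Fin m → ℝ)}
    (hp : ∀ i, IsHomogPolym m k (fun x => p x i)) (c : ℝ) (x : Fin m → ℝ) :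
    dotm m (c • x) (p (c • x)) = c ^ (k + 1) * dotm m x (p x) := by
  simp only [dotm, Finset.mul_sum, (hp _).map_smul, Pi.smul_apply, smul_eq_mul]
  exact Finset.sum_congr rfl fun i _ => by ring

lemma normm_nonneg (m : ℕ) (x : Fin m → ℝ) : 0 ≤ normm m x := Real.sqrt_nonneg _

lemma normm_smul {m : ℕ} {c : ℝ} (hc : 0 ≤ c) (x : Fin m → ℝ) :
    normm m (c • x) = c * normm m x := by
  have h : dotm m (c • x) (c • x) = c ^ 2 * dotm m x x := by
    simp only [dotm, Finset.mul_sum, Pi.smul_apply, smul_eq_mul]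
    exact Finset.sum_congr rfl fun i _ => by ring
  rw [normm, h, Real.sqrt_mul (sq_nonneg c), Real.sqrt_sq hc, normm]

lemma eq_zero_of_normm_eq_zero {m : ℕ} {x : Fin m → ℝ} (h : normm m x = 0) : x = 0 := by
  have hnn : 0 ≤ dotm m x x := Finset.sum_nonneg fun i _ => mul_self_nonneg (x i)
  have h0 : dotm m x x = 0 := (Real.sqrt_eq_zero hnn).1 h
  ext i
  exact mul_self_eq_zero.1
    ((Finset.sum_eq_zero_iff_of_nonneg fun i _ => mul_self_nonneg (x i)).1 h0 i (Finset.mem_univ i))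

lemma hasFDerivAt_normm {m : ℕ} {x : Fin m → ℝ} (hx : normm m x ≠ 0) :
    HasFDerivAt (normm m)
      ((normm m x)⁻¹ • ∑ i, x i • ContinuousLinearMap.proj (R := ℝ) (φ := fun _ : Fin m => ℝ) i)
      x := by
  have h0 : dotm m x x ≠ 0 := fun h => hx (by rw [normm, h, Real.sqrt_zero])
  have hd : HasFDerivAt (fun y => dotm m y y)
      (∑ i, (x i • ContinuousLinearMap.proj (R := ℝ) (φ := fun _ : Fin m => ℝ) i +
        x i • ContinuousLinearMap.proj (R := ℝ) (φ := fun _ : Fin m => ℝ) i)) x :=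
    HasFDerivAt.fun_sum fun i _ => (hasFDerivAt_apply i x).mul (hasFDerivAt_apply i x)
  refine (hd.sqrt h0).congr_fderiv ?_
  rw [Finset.sum_add_distrib, ← two_smul ℝ, smul_smul]
  congr 1
  rw [normm]
  field_simp

lemma hasFDerivAt_inv_normm_pow {m : ℕ} (N : ℕ) {x : Fin m → ℝ} (hx : normm m x ≠ 0) :
    HasFDerivAt (fun y => (normm m y ^ N)⁻¹)
      ((-(N / normm m x ^ (N + 2))) •
        ∑ i, x i • ContinuousLinearMap.proj (R := ℝ) (φ := fun _ : Fin m => ℝ) i) x := by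
  have hinv := (hasDerivAt_inv (pow_ne_zero N hx)).comp (normm m x) (hasDerivAt_pow N (normm m x))
  refine (hinv.comp_hasFDerivAt x (hasFDerivAt_normm hx)).congr_fderiv ?_
  rw [smul_smul]
  congr 1
  rcases N with _ | N
  · simp
  · simp only [Nat.add_sub_cancel]
    field_simp
    ring

lemma divm_kelvinm {m k : ℕ} {p : (Fin m → ℝ) → (Fin m → ℝ)} {x : Fin m → ℝ}
    (hp : ∀ i, DifferentiableAt ℝ (fun y => p y i) x) (hx : normm m x ≠ 0) :
    divm m (kelvinm m k p) x =
      (normm m x ^ (2 * k + m - 2))⁻¹ * divm m p x -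
        ((2 * k + m - 2 : ℕ) : ℝ) / normm m x ^ (2 * k + m - 2 + 2) * dotm m x (p x) := by
  simp only [divm, dotm, Finset.mul_sum, ← Finset.sum_sub_distrib]
  refine Finset.sum_congr rfl fun i _ => ?_
  have h : HasFDerivAt (fun y => kelvinm m k p y i) _ x :=
    (hasFDerivAt_inv_normm_pow (2 * k + m - 2) hx).mul (hp i).hasFDerivAt
  rw [pdm, h.fderiv]
  simp only [pdm, add_apply, smul_apply, sum_apply, ContinuousLinearMap.proj_apply,
    Pi.single_apply, smul_eq_mul, mul_ite, mul_one, mul_zero, Finset.sum_ite_eq',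
    Finset.mem_univ, if_true]
  ring

/-- Let `m ≥ 3`, `k ≥ 0`, and let `p` have homogeneous polynomial
components of degree `k` on `ℝ^m`. If `∇·p = 0` on the open unit ball and the Kelvin
transform `p*(x) = |x|^{−(2k+m−2)} p(x)` satisfies `∇·p* = 0` for `|x| > 1`, then `∇·p = 0`
on all of `ℝ^m` and `x·p(x) = 0` for every `x ∈ ℝ^m`. -/
theorem div_free_inside_outside_higher (m k : ℕ) (hm : 3 ≤ m)
    (p : (Fin m → ℝ) → (Fin m → ℝ))
    (hp : ∀ i, IsHomogPolym m k (fun x => p x i))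
    (hin : ∀ x : Fin m → ℝ, normm m x < 1 → divm m p x = 0)
    (hout : ∀ x : Fin m → ℝ, 1 < normm m x → divm m (kelvinm m k p) x = 0) :
    (∀ x, divm m p x = 0) ∧ ∀ x, dotm m x (p x) = 0 := by
  have hdiv : ∀ x, divm m p x = 0 := fun x => by
    have hpos : 0 < normm m x + 1 := by linarith [normm_nonneg m x]
    have hsmall : normm m ((normm m x + 1)⁻¹ • x) < 1 := by
      rw [normm_smul (inv_nonneg.2 hpos.le), inv_mul_lt_one₀ hpos]
      linarith
    have h := mul_divm_smul hp (normm m x + 1)⁻¹ x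
    rw [hin _ hsmall, mul_zero] at h
    exact (mul_eq_zero.1 h.symm).resolve_left (pow_ne_zero k (inv_ne_zero hpos.ne'))
  refine ⟨hdiv, fun x => ?_⟩
  have hdot : ∀ y, 1 < normm m y → dotm m y (p y) = 0 := fun y hy => by
    have hy0 : normm m y ≠ 0 := by linarith
    have h := divm_kelvinm (k := k) (fun i => (hp i).differentiable y) hy0
    rw [hout y hy, hdiv y, mul_zero, zero_sub, eq_comm, neg_eq_zero] at h
    refine (mul_eq_zero.1 h).resolve_left (div_ne_zero ?_ (pow_ne_zero _ hy0))
    exact Nat.cast_ne_zero.2 (by omega)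
  rcases eq_or_ne (normm m x) 0 with h0 | h0
  · simp [eq_zero_of_normm_eq_zero h0, dotm]
  · have hc : 0 < 2 / normm m x := div_pos two_pos ((normm_nonneg m x).lt_of_ne' h0)
    have hbig : 1 < normm m ((2 / normm m x) • x) := by
      rw [normm_smul hc.le, div_mul_cancel₀ _ h0]
      norm_num
    have h := dotm_smul_apply_smul hp (2 / normm m x) x
    rw [hdot _ hbig] at h
    exact (mul_eq_zero.1 h.symm).resolve_left (pow_ne_zero _ hc.ne')
end
end
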